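/- arXiv:2210.05744 — 3 statements merged into one kernel-verified Lean document; each statement's English description precedes it below -/
import Mathlib

section
/- Key estimate in the proof of Lemma B.1: let N ∈ ℕ, ν₀ ∈ (0,1), and φ > 0. Then there exist ν₁ ∈ (0,1) and C > 0 such that for every s ∈ ℂ with Re s < log ν₁ and |Im s| < φ, every integer j ≥ 2, and every k ∈ ℤ with k ≤ N·j, one has |k + j·s| · |s|^{k−1} · e^{(j−1)·Re s} ≤ C · |log ν₀|^k · ν₀^j. -/
/-- For large `x`, exponential decay beats the polynomial factor. -/
lemma kse_decay (N : ℕ) (L a φ : ℝ) (ha : 0 < a) :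
    ∃ X : ℝ, ∀ x : ℝ, X ≤ x → 2 * ((x + φ) / L) ^ N * Real.exp (-(x / 2)) ≤ a := by
  have h0 := Real.tendsto_pow_mul_exp_neg_atTop_nhds_zero N
  have h1 : Filter.Tendsto (fun x : ℝ => (x + φ) / 2) Filter.atTop Filter.atTop :=
    (Filter.tendsto_atTop_add_const_right _ φ Filter.tendsto_id).atTop_div_const (by norm_num)
  have h2 := (h0.comp h1).const_mul (2 * (2 / L) ^ N * Real.exp (φ / 2))
  rw [mul_zero] at h2
  obtain ⟨X, hX⟩ := Filter.eventually_atTop.1 (h2.eventually (ge_mem_nhds ha))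
  refine ⟨X, fun x hx => ?_⟩
  have h3 := hX x hx
  simp only [Function.comp] at h3
  refine le_of_eq_of_le ?_ h3
  have e1 : Real.exp (-(x / 2)) = Real.exp (φ / 2) * Real.exp (-((x + φ) / 2)) := by
    rw [← Real.exp_add]; congr 1; ring
  have e2 : (x + φ) / L = (2 / L) * ((x + φ) / 2) := by ring
  rw [e1, e2, mul_pow]; ring

lemma kse_combinatorial (N j : ℕ) (hj : 2 ≤ j) (t : ℝ) (ht : 2 ≤ t) (k : ℤ)
    (hk : k ≤ (N : ℤ) * (j : ℤ)) :
    (|(k : ℝ)| + j) * t ^ k ≤ (N + 2) * (2 * t ^ N) ^ j := by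
  obtain ⟨m, hm⟩ := Int.eq_ofNat_of_zero_le (sub_nonneg.2 hk)
  have hk' : k = ((N * j : ℕ) : ℤ) - (m : ℤ) := by push_cast; omega
  have ht0 : (0 : ℝ) < t := by linarith
  have hkr : (k : ℝ) = (N : ℝ) * j - m := by rw [hk']; push_cast; ring
  have habs : |(k : ℝ)| ≤ (N : ℝ) * j + m := by
    rw [hkr, abs_le]
    have : (0 : ℝ) ≤ (N : ℝ) * j := by positivity
    have : (0 : ℝ) ≤ (m : ℝ) := by positivity
    constructor <;> linarith
  have hm2 : (m : ℝ) ≤ t ^ m := by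
    have h1 : (m : ℝ) ≤ 2 ^ m := by exact_mod_cast (Nat.lt_two_pow_self (n := m)).le
    exact h1.trans (pow_le_pow_left₀ (by norm_num) ht m)
  have hm1 : (1 : ℝ) ≤ t ^ m := one_le_pow₀ (by linarith)
  have hj2 : (j : ℝ) ≤ 2 ^ j := by exact_mod_cast (Nat.lt_two_pow_self (n := j)).le
  have hj1 : (1 : ℝ) ≤ j := by exact_mod_cast (by omega : 1 ≤ j)
  have key : |(k : ℝ)| + j ≤ (N + 2) * 2 ^ j * t ^ m := by
    have a1 : ((N : ℝ) + 1) * j ≤ ((N : ℝ) + 1) * j * t ^ m :=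
      le_mul_of_one_le_right (by positivity) hm1
    have a2 : (m : ℝ) ≤ j * t ^ m := by nlinarith
    have a3 : ((N : ℝ) + 2) * j * t ^ m ≤ (N + 2) * 2 ^ j * t ^ m := by gcongr
    linarith
  have hz : t ^ k = t ^ (N * j) / t ^ m := by
    rw [hk', zpow_sub₀ ht0.ne', zpow_natCast, zpow_natCast]
  rw [hz, mul_div_assoc', div_le_iff₀ (by positivity), mul_pow, ← pow_mul]
  calc (|(k : ℝ)| + j) * t ^ (N * j) ≤ ((N + 2) * 2 ^ j * t ^ m) * t ^ (N * j) := by gcongr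
    _ = _ := by ring

/-- Key estimate in the proof of Lemma B.1: for `N ∈ ℕ`, `ν₀ ∈ (0,1)`, `φ > 0`, there
are `ν₁ ∈ (0,1)` and `C > 0` such that on the sector `{Re s < log ν₁, |Im s| < φ}`
(`s = log ν`), for all integers `j ≥ 2` and `k ≤ N·j`,
`|k + j·s| · |s|^{k-1} · e^{(j-1) Re s} ≤ C · |log ν₀|^k · ν₀^j`. -/
theorem key_sector_estimate
    (N : ℕ) (ν₀ : ℝ) (hν₀ : ν₀ ∈ Set.Ioo (0 : ℝ) 1) (φ : ℝ) (hφ : 0 < φ) :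
    ∃ ν₁ ∈ Set.Ioo (0 : ℝ) 1, ∃ C : ℝ, 0 < C ∧
      ∀ s : ℂ, s.re < Real.log ν₁ → |s.im| < φ →
        ∀ j : ℕ, 2 ≤ j → ∀ k : ℤ, k ≤ (N : ℤ) * (j : ℤ) →
          ‖(k : ℂ) + (j : ℂ) * s‖ * ‖s‖ ^ (k - 1) *
              Real.exp (((j : ℝ) - 1) * s.re) ≤
            C * |Real.log ν₀| ^ k * ν₀ ^ j := by
  obtain ⟨h0, h1⟩ := hν₀
  have hL : 0 < |Real.log ν₀| := abs_pos.2 (Real.log_neg h0 h1).ne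
  set L := |Real.log ν₀| with hLdef
  obtain ⟨X, hX⟩ := kse_decay N L ν₀ φ h0
  refine ⟨Real.exp (-(|X| + 2 * L + 1)), ⟨Real.exp_pos _, ?_⟩, (N : ℝ) + 2, by positivity, ?_⟩
  · rw [Real.exp_lt_one_iff]
    have := abs_nonneg X
    linarith
  intro s hs him j hj k hk
  rw [Real.log_exp] at hs
  have hXa := le_abs_self X
  have hXn := abs_nonneg X
  have hx1 : |s.re| = -s.re := abs_of_neg (by linarith)
  have hr1 : -s.re ≤ ‖s‖ := hx1 ▸ Complex.abs_re_le_norm s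
  have hr2 : ‖s‖ ≤ -s.re + φ := by
    have := Complex.norm_le_abs_re_add_abs_im s
    linarith
  have hrpos : 0 < ‖s‖ := by linarith
  have ht : 2 ≤ ‖s‖ / L := by rw [le_div_iff₀ hL]; linarith
  have hcomb := kse_combinatorial N j hj (‖s‖ / L) ht k hk
  have hdec := hX (-s.re) (by linarith)
  have hjr : (2 : ℝ) ≤ j := by exact_mod_cast hj
  have hn : ‖(k : ℂ) + (j : ℂ) * s‖ ≤ (|(k : ℝ)| + j) * ‖s‖ := by
    have h := norm_add_le (k : ℂ) ((j : ℂ) * s)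
    rw [norm_mul, Complex.norm_intCast, Complex.norm_natCast] at h
    have : |(k : ℝ)| ≤ |(k : ℝ)| * ‖s‖ := le_mul_of_one_le_right (abs_nonneg _) (by linarith)
    linarith
  have he : Real.exp (((j : ℝ) - 1) * s.re) ≤ Real.exp (-(-s.re / 2)) ^ j := by
    rw [← Real.exp_nat_mul, Real.exp_le_exp]
    nlinarith
  have hpk : ‖s‖ * ‖s‖ ^ (k - 1) = (‖s‖ / L) ^ k * L ^ k := by
    rw [← mul_zpow, div_mul_cancel₀ _ hL.ne', mul_comm, zpow_sub_one₀ hrpos.ne',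
      inv_mul_cancel_right₀ hrpos.ne']
  have hLk : 0 < L ^ k := zpow_pos hL k
  have hbase : 2 * (‖s‖ / L) ^ N * Real.exp (-(-s.re / 2)) ≤ ν₀ := by
    refine le_trans ?_ hdec
    gcongr
  calc ‖(k : ℂ) + (j : ℂ) * s‖ * ‖s‖ ^ (k - 1) * Real.exp (((j : ℝ) - 1) * s.re)
      ≤ ((|(k : ℝ)| + j) * ‖s‖) * ‖s‖ ^ (k - 1) * Real.exp (-(-s.re / 2)) ^ j := by gcongr
    _ = ((|(k : ℝ)| + j) * (‖s‖ / L) ^ k) * (L ^ k * Real.exp (-(-s.re / 2)) ^ j) := by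
        rw [mul_assoc (|(k : ℝ)| + j), hpk]; ring
    _ ≤ ((N + 2) * (2 * (‖s‖ / L) ^ N) ^ j) * (L ^ k * Real.exp (-(-s.re / 2)) ^ j) := by
        gcongr
    _ = (N + 2) * L ^ k * (2 * (‖s‖ / L) ^ N * Real.exp (-(-s.re / 2))) ^ j := by
        rw [mul_pow _ (Real.exp _)]; ring
    _ ≤ (N + 2) * L ^ k * ν₀ ^ j := by gcongr
end

section
/- First variational formula (Hadamard / Feynman–Hellmann): let H be a complex Hilbert space, (α,β) ⊂ ℝ an open interval, and τ₀ ∈ (α,β). Let A, A' : ℝ → (H →L[ℂ] H), φ : ℝ → H, φ'₀ ∈ H, and σ : ℝ → ℝ. Assume: (i) A(τ) is self-adjoint for every τ ∈ (α,β); (ii) A has derivative A'(τ₀) at τ₀ (in operator norm) and φ has derivative φ'₀ at τ₀; (iii) ‖φ(τ)‖ = 1 for all τ ∈ (α,β); (iv) A(τ)(φ(τ)) = σ(τ) • φ(τ) for all τ ∈ (α,β). Then σ is differentiable at τ₀ with σ'(τ₀) = Re⟨A'(τ₀)(φ(τ₀)), φ(τ₀)⟩. -/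
/-- First variational formula (Hadamard / Feynman–Hellmann): if `A(τ)` is a `C¹` family
of bounded self-adjoint operators on a complex Hilbert space, `φ(τ)` a `C¹` family of
unit eigenvectors with eigenvalues `σ(τ)`, then `σ` is differentiable at `τ₀` with
`σ'(τ₀) = Re⟨A'(τ₀)φ(τ₀), φ(τ₀)⟩`. -/
theorem first_variational_formula
    {H : Type*} [NormedAddCommGroup H] [InnerProductSpace ℂ H] [CompleteSpace H]
    (α β τ₀ : ℝ) (hτ₀ : τ₀ ∈ Set.Ioo α β)
    (A A' : ℝ → H →L[ℂ] H) (φ : ℝ → H) (φ'₀ : H) (σ : ℝ → ℝ)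
    (hsa : ∀ τ ∈ Set.Ioo α β, ∀ x y : H, (inner ℂ (A τ x) y : ℂ) = inner ℂ x (A τ y))
    (hA : HasDerivAt A (A' τ₀) τ₀)
    (hφ : HasDerivAt φ φ'₀ τ₀)
    (hnorm : ∀ τ ∈ Set.Ioo α β, ‖φ τ‖ = 1)
    (heig : ∀ τ ∈ Set.Ioo α β, A τ (φ τ) = σ τ • φ τ) :
    HasDerivAt σ ((inner ℂ (A' τ₀ (φ τ₀)) (φ τ₀) : ℂ).re) τ₀ := by
  have hB : HasDerivAt (fun τ => (A τ).restrictScalars ℝ) ((A' τ₀).restrictScalars ℝ) τ₀ :=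
    (ContinuousLinearMap.restrictScalarsL ℂ H H ℝ ℝ).hasFDerivAt.comp_hasDerivAt τ₀ hA
  have hAφ : HasDerivAt (fun τ => A τ (φ τ)) (A' τ₀ (φ τ₀) + A τ₀ φ'₀) τ₀ :=
    hB.clm_apply hφ
  have hmem : ∀ᶠ τ in nhds τ₀, τ ∈ Set.Ioo α β := isOpen_Ioo.mem_nhds hτ₀
  have hself : ∀ τ ∈ Set.Ioo α β, (inner ℂ (φ τ) (φ τ) : ℂ) = 1 := by
    intro τ hτ
    rw [inner_self_eq_norm_sq_to_K, hnorm τ hτ]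
    simp
  have hsm : ∀ (r : ℝ) (x : H), r • x = (r : ℂ) • x := fun r x => (Complex.coe_smul r x).symm
  have hN := hφ.inner ℂ hφ
  have hN1 : HasDerivAt (fun τ => (inner ℂ (φ τ) (φ τ) : ℂ)) 0 τ₀ :=
    (hasDerivAt_const τ₀ (1 : ℂ)).congr_of_eventuallyEq (hmem.mono hself)
  have hz : (inner ℂ (φ τ₀) φ'₀ : ℂ) + inner ℂ φ'₀ (φ τ₀) = 0 := hN.unique hN1
  have hI := hAφ.inner ℂ hφ
  have hval : (inner ℂ (A τ₀ (φ τ₀)) φ'₀ : ℂ) + inner ℂ (A' τ₀ (φ τ₀) + A τ₀ φ'₀) (φ τ₀)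
      = inner ℂ (A' τ₀ (φ τ₀)) (φ τ₀) := by
    rw [inner_add_left, hsa τ₀ hτ₀ φ'₀ (φ τ₀), heig τ₀ hτ₀, hsm, inner_smul_left,
      inner_smul_right, Complex.conj_ofReal]
    linear_combination (σ τ₀ : ℂ) * hz
  rw [hval] at hI
  have hR : HasDerivAt (fun τ => (inner ℂ (A τ (φ τ)) (φ τ) : ℂ).re)
      ((inner ℂ (A' τ₀ (φ τ₀)) (φ τ₀) : ℂ).re) τ₀ :=
    Complex.reCLM.hasFDerivAt.comp_hasDerivAt τ₀ hI
  refine hR.congr_of_eventuallyEq (hmem.mono fun τ hτ => ?_)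
  change σ τ = (inner ℂ (A τ (φ τ)) (φ τ) : ℂ).re
  rw [heig τ hτ, hsm, inner_smul_left, hself τ hτ]
  simp
end

section
/- Second variational formula: let H be a complex Hilbert space, (α,β) ⊂ ℝ an open interval, τ₀ ∈ (α,β). Let A, A', A'' : ℝ → (H →L[ℂ] H) with A(τ) self-adjoint for τ ∈ (α,β), A differentiable on (α,β) with derivative A', and A' differentiable at τ₀ with derivative A''(τ₀). Let φ₁ : ℝ → H be twice differentiable on (α,β) with ‖φ₁(τ)‖ = 1, and σ₁ : ℝ → ℝ with A(τ)(φ₁(τ)) = σ₁(τ) • φ₁(τ) for τ ∈ (α,β). Suppose (e_n)_{n ∈ ℕ} is an orthonormal family in H whose span is dense, with e_0 = φ₁(τ₀), and there are reals (μ_n)_{n ∈ ℕ} with A(τ₀)e_n = μ_n • e_n for all n, μ_0 = σ₁(τ₀), and μ_n ≠ μ_0 for all n ≥ 1. Then σ₁ is twice differentiable at τ₀, the family n ↦ |⟨A'(τ₀)(φ₁(τ₀)), e_n⟩|²/(μ_0 − μ_n) (over n ≥ 1) is summable, and σ₁''(τ₀) = Re⟨A''(τ₀)(φ₁(τ₀)),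 φ₁(τ₀)⟩ + 2 Σ_{n ≥ 1} |⟨A'(τ₀)(φ₁(τ₀)), e_n⟩|² / (μ_0 − μ_n). -/
/-- Product rule for a real-parameter family of complex-linear operators applied to a vector. -/
lemma hasDerivAt_apply_aux
    {H : Type*} [NormedAddCommGroup H] [InnerProductSpace ℂ H]
    {A : ℝ → H →L[ℂ] H} {B : H →L[ℂ] H} {f : ℝ → H} {g : H} {t : ℝ}
    (hA : HasDerivAt A B t) (hf : HasDerivAt f g t) :
    HasDerivAt (fun s => A s (f s)) (B (f t) + A t g) t := by
  have h1 : HasDerivAt (fun s => (A s).restrictScalars ℝ) (B.restrictScalars ℝ) t :=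
    (ContinuousLinearMap.restrictScalarsL ℂ H H ℝ ℝ).hasFDerivAt.comp_hasDerivAt t hA
  exact h1.clm_apply hf

/-- Real part of a differentiable complex-valued function. -/
lemma hasDerivAt_re_aux {f : ℝ → ℂ} {g : ℂ} {t : ℝ} (hf : HasDerivAt f g t) :
    HasDerivAt (fun s => (f s).re) g.re t :=
  Complex.reCLM.hasFDerivAt.comp_hasDerivAt t hf

/-- Second variational formula: for a `C²` family of bounded self-adjoint operators
`A(τ)` with a `C²` family of unit eigenvectors `φ₁(τ)`, eigenvalues `σ₁(τ)`, and a
complete orthonormal eigenbasis `(e_n)` of `A(τ₀)` with `e_0 = φ₁(τ₀)` and simple lowest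
eigenvalue, `σ₁` is twice differentiable at `τ₀` and
`σ₁''(τ₀) = Re⟨A''(τ₀)φ₁, φ₁⟩ + 2 Σ_{n≥1} |⟨A'(τ₀)φ₁, e_n⟩|²/(μ₀ − μ_n)`. -/
theorem second_variational_formula
    {H : Type*} [NormedAddCommGroup H] [InnerProductSpace ℂ H] [CompleteSpace H]
    (α β τ₀ : ℝ) (hτ₀ : τ₀ ∈ Set.Ioo α β)
    (A A' A'' : ℝ → H →L[ℂ] H)
    (hsa : ∀ τ ∈ Set.Ioo α β, ∀ x y : H, (inner ℂ (A τ x) y : ℂ) = inner ℂ x (A τ y))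
    (hA : ∀ τ ∈ Set.Ioo α β, HasDerivAt A (A' τ) τ)
    (hA' : HasDerivAt A' (A'' τ₀) τ₀)
    (φ₁ φ₁' φ₁'' : ℝ → H)
    (hφ₁ : ∀ τ ∈ Set.Ioo α β, HasDerivAt φ₁ (φ₁' τ) τ)
    (hφ₁' : ∀ τ ∈ Set.Ioo α β, HasDerivAt φ₁' (φ₁'' τ) τ)
    (hnorm : ∀ τ ∈ Set.Ioo α β, ‖φ₁ τ‖ = 1)
    (σ₁ : ℝ → ℝ)
    (heig : ∀ τ ∈ Set.Ioo α β, A τ (φ₁ τ) = σ₁ τ • φ₁ τ)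
    (e : ℕ → H) (he : Orthonormal ℂ e)
    (hdense : Dense (Submodule.span ℂ (Set.range e) : Set H))
    (he0 : e 0 = φ₁ τ₀)
    (μ : ℕ → ℝ) (heigbasis : ∀ n, A τ₀ (e n) = μ n • e n)
    (hμ0 : μ 0 = σ₁ τ₀) (hsimple : ∀ n : ℕ, 1 ≤ n → μ n ≠ μ 0) :
    ∃ σ₁' : ℝ → ℝ, ∃ d : ℝ,
      (∀ τ ∈ Set.Ioo α β, HasDerivAt σ₁ (σ₁' τ) τ) ∧
      HasDerivAt σ₁' d τ₀ ∧
      Summable (fun n : ℕ =>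
        ‖(inner ℂ (A' τ₀ (φ₁ τ₀)) (e (n + 1)) : ℂ)‖ ^ 2 / (μ 0 - μ (n + 1))) ∧
      d = (inner ℂ (A'' τ₀ (φ₁ τ₀)) (φ₁ τ₀) : ℂ).re +
        2 * ∑' n : ℕ,
          ‖(inner ℂ (A' τ₀ (φ₁ τ₀)) (e (n + 1)) : ℂ)‖ ^ 2 / (μ 0 - μ (n + 1)) := by
  have hnhds : ∀ τ ∈ Set.Ioo α β, Set.Ioo α β ∈ nhds τ := fun τ h => isOpen_Ioo.mem_nhds h
  have hself : ∀ τ ∈ Set.Ioo α β, (inner ℂ (φ₁ τ) (φ₁ τ) : ℂ) = 1 := by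
    intro τ h
    rw [inner_self_eq_norm_sq_to_K, hnorm τ h]; simp
  have hresym : ∀ x y : H, (inner ℂ x y : ℂ).re = (inner ℂ y x : ℂ).re := by
    intro x y
    rw [← inner_conj_symm, Complex.conj_re]
  have horth : ∀ τ ∈ Set.Ioo α β, (inner ℂ (φ₁ τ) (φ₁' τ) : ℂ).re = 0 := by
    intro τ h
    have h1 := hasDerivAt_re_aux ((hφ₁ τ h).inner ℂ (hφ₁ τ h))
    have h2 : HasDerivAt (fun s => (inner ℂ (φ₁ s) (φ₁ s) : ℂ).re) 0 τ := by
      refine (hasDerivAt_const τ (1 : ℝ)).congr_of_eventuallyEq ?_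
      filter_upwards [hnhds τ h] with s hs
      rw [hself s hs]; simp
    have h3 := h1.unique h2
    rw [Complex.add_re, hresym (φ₁' τ) (φ₁ τ)] at h3
    linarith
  have hsa' : ∀ τ ∈ Set.Ioo α β, ∀ x y : H,
      (inner ℂ (A' τ x) y : ℂ) = inner ℂ x (A' τ y) := by
    intro τ h x y
    have hx := hasDerivAt_apply_aux (hA τ h) (hasDerivAt_const τ x)
    have hy := hasDerivAt_apply_aux (hA τ h) (hasDerivAt_const τ y)
    have h1 := hx.inner ℂ (hasDerivAt_const τ y)
    have h2 := (hasDerivAt_const τ x).inner ℂ hy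
    have h3 := h1.congr_of_eventuallyEq (f₁ := fun s => (inner ℂ x (A s y) : ℂ)) (by
      filter_upwards [hnhds τ h] with s hs
      exact (hsa s hs x y).symm)
    simpa using h3.unique h2
  have hσ : ∀ τ ∈ Set.Ioo α β,
      HasDerivAt σ₁ ((inner ℂ (A' τ (φ₁ τ)) (φ₁ τ) : ℂ).re) τ := by
    intro τ h
    have h1 := hasDerivAt_re_aux
      ((hasDerivAt_apply_aux (hA τ h) (hφ₁ τ h)).inner ℂ (hφ₁ τ h))
    have h2 := h1.congr_of_eventuallyEq (f₁ := σ₁) (by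
      filter_upwards [hnhds τ h] with s hs
      rw [heig s hs, ← Complex.coe_smul, inner_smul_left, hself s hs]; simp)
    refine h2.congr_deriv ?_
    have h4 := horth τ h
    rw [inner_add_left, hsa τ h (φ₁' τ), heig τ h, ← Complex.coe_smul, inner_smul_left, inner_smul_right]
    have h5 := hresym (φ₁' τ) (φ₁ τ)
    simp [h4, h5]
  have hd := hasDerivAt_re_aux
    ((hasDerivAt_apply_aux hA' (hφ₁ τ₀ hτ₀)).inner ℂ (hφ₁ τ₀ hτ₀))
  have heq : A' τ₀ (φ₁ τ₀) + A τ₀ (φ₁' τ₀) =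
      σ₁ τ₀ • φ₁' τ₀ + ((inner ℂ (A' τ₀ (φ₁ τ₀)) (φ₁ τ₀) : ℂ).re) • φ₁ τ₀ := by
    have h1 := hasDerivAt_apply_aux (hA τ₀ hτ₀) (hφ₁ τ₀ hτ₀)
    have h2 := (hσ τ₀ hτ₀).smul (hφ₁ τ₀ hτ₀)
    refine h1.unique (h2.congr_of_eventuallyEq ?_)
    filter_upwards [hnhds τ₀ hτ₀] with s hs
    exact heig s hs
  have hcoef : ∀ n : ℕ, (inner ℂ (A' τ₀ (φ₁ τ₀)) (e (n + 1)) : ℂ) =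
      ((μ 0 - μ (n + 1) : ℝ) : ℂ) * inner ℂ (φ₁' τ₀) (e (n + 1)) := by
    intro n
    have h1 := congrArg (fun v => (inner ℂ v (e (n + 1)) : ℂ)) heq
    have h0 : (inner ℂ (φ₁ τ₀) (e (n + 1)) : ℂ) = 0 := by
      rw [← he0]; exact he.2 (by simp)
    simp only [inner_add_left] at h1
    rw [hsa τ₀ hτ₀, heigbasis, ← Complex.coe_smul, ← Complex.coe_smul, ← Complex.coe_smul,
      inner_smul_left, inner_smul_left, inner_smul_right, h0, ← hμ0] at h1
    simp only [Complex.conj_ofReal, mul_zero, add_zero] at h1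
    push_cast
    linear_combination h1
  let b : HilbertBasis ℕ ℂ H := HilbertBasis.mk he (by
    rw [Submodule.dense_iff_topologicalClosure_eq_top.mp hdense])
  have hb : ∀ n, b n = e n := fun n => by simp [b]
  have hsum := Complex.hasSum_re (b.hasSum_inner_mul_inner (A' τ₀ (φ₁ τ₀)) (φ₁' τ₀))
  simp only [hb] at hsum
  have hz : ((inner ℂ (A' τ₀ (φ₁ τ₀)) (e 0) : ℂ) * inner ℂ (e 0) (φ₁' τ₀)).re = 0 := by
    rw [he0, Complex.mul_re, horth τ₀ hτ₀]
    have him : (inner ℂ (A' τ₀ (φ₁ τ₀)) (φ₁ τ₀) : ℂ).im = 0 := by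
      have h1 : (starRingEnd ℂ) (inner ℂ (A' τ₀ (φ₁ τ₀)) (φ₁ τ₀) : ℂ)
          = inner ℂ (A' τ₀ (φ₁ τ₀)) (φ₁ τ₀) := by
        rw [inner_conj_symm, hsa' τ₀ hτ₀]
      exact Complex.conj_eq_iff_im.mp h1
    rw [him]; simp
  have hS : HasSum (fun n : ℕ =>
      ‖(inner ℂ (A' τ₀ (φ₁ τ₀)) (e (n + 1)) : ℂ)‖ ^ 2 / (μ 0 - μ (n + 1)))
      (inner ℂ (A' τ₀ (φ₁ τ₀)) (φ₁' τ₀) : ℂ).re := by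
    have h1 := (hasSum_nat_add_iff' 1).mpr hsum
    simp only [Finset.sum_range_one, hz, sub_zero] at h1
    refine h1.congr_fun ?_
    intro n
    have hne : μ 0 - μ (n + 1) ≠ 0 := sub_ne_zero.mpr (hsimple (n + 1) (by omega)).symm
    rw [hcoef n, ← inner_conj_symm (e (n + 1)) (φ₁' τ₀), mul_assoc, Complex.mul_conj,
      ← Complex.ofReal_mul, Complex.ofReal_re, norm_mul, Complex.norm_real, mul_pow,
      Complex.normSq_eq_norm_sq, Real.norm_eq_abs, sq_abs]
    field_simp
  refine ⟨fun τ => (inner ℂ (A' τ (φ₁ τ)) (φ₁ τ) : ℂ).re, _, hσ, hd, hS.summable, ?_⟩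
  rw [hS.tsum_eq, inner_add_left, hsa' τ₀ hτ₀ (φ₁' τ₀), Complex.add_re, Complex.add_re,
    hresym (φ₁' τ₀)]
  ring
end
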